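/- If A ⊆ A_{Φ̃⁺} is a free arrangement (i.e., Der(A) is a free S-module), then 𝔦_A = (S^{S_n}_+) : β_A, where β_A := ∏_{0 ≤ i < j ≤ n, H_{i,j} ∉ A} α_{i,j}. -/

import Mathlib

open MvPolynomial

noncomputable section

/-- `varx K n i` is the variable `x_i` for `1 ≤ i ≤ n`, with the convention `x_0 = 0`. -/
def varx (K : Type*) [Field K] (n : ℕ) (i : Fin (n + 1)) : MvPolynomial (Fin n) K :=
  if h : (i : ℕ) = 0 then 0 else X ⟨(i : ℕ) - 1, by have := i.isLt; omega⟩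

/-- The linear form `α_{i,j}`: equal to `x_j` when `i = 0` and `x_i − x_j` when `i ≥ 1`. -/
def alp (K : Type*) [Field K] (n : ℕ) (i j : Fin (n + 1)) : MvPolynomial (Fin n) K :=
  if i = 0 then varx K n j else varx K n i - varx K n j

/-- Defining polynomial `Q(A)` of an arrangement encoded by its index pairs. -/
def QA (K : Type*) [Field K] (n : ℕ) (A : Finset (Fin (n + 1) × Fin (n + 1))) :
    MvPolynomial (Fin n) K :=
  ∏ p ∈ A, alp K n p.1 p.2

/-- The module of derivations `θ` with `q ∣ θ(q)`; for `q = Q(A)` this is `Der(A)`. -/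
def DerOf (K : Type*) [Field K] (n : ℕ) (q : MvPolynomial (Fin n) K) :
    Submodule (MvPolynomial (Fin n) K)
      (Derivation K (MvPolynomial (Fin n) K) (MvPolynomial (Fin n) K)) where
  carrier := {θ | q ∣ θ q}
  add_mem' := by
    intro a b ha hb
    simpa using dvd_add ha hb
  zero_mem' := by simp
  smul_mem' := by
    intro c θ hθ
    simpa [smul_eq_mul] using Dvd.dvd.mul_left hθ c

/-- The `S`-module map `𝔦 : Der(S) → S`, `θ ↦ Σ_k θ(x_k)`, i.e. `∂_k ↦ 1`. -/
def iMap (K : Type*) [Field K] (n : ℕ) :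
    Derivation K (MvPolynomial (Fin n) K) (MvPolynomial (Fin n) K)
      →ₗ[MvPolynomial (Fin n) K] MvPolynomial (Fin n) K where
  toFun θ := ∑ k : Fin n, θ (X k)
  map_add' := by intro a b; simp [Finset.sum_add_distrib]
  map_smul' := by intro c θ; simp [Finset.mul_sum]

/-- The Solomon–Terao ideal `𝔦_A = 𝔦(Der(A))`. -/
def iIdeal (K : Type*) [Field K] (n : ℕ) (A : Finset (Fin (n + 1) × Fin (n + 1))) :
    Ideal (MvPolynomial (Fin n) K) :=
  Submodule.map (iMap K n) (DerOf K n (QA K n A))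


def coinvIdeal (K : Type*) [Field K] (n : ℕ) : Ideal (MvPolynomial (Fin n) K) :=
  Ideal.span {f | f.IsSymmetric ∧ constantCoeff f = 0}

/-- `β_A = ∏_{0 ≤ i < j ≤ n, H_{i,j} ∉ A} α_{i,j}`. -/
def betaA (K : Type*) [Field K] (n : ℕ) (A : Finset (Fin (n + 1) × Fin (n + 1))) :
    MvPolynomial (Fin n) K :=
  ∏ p ∈ Finset.univ.filter fun p : Fin (n + 1) × Fin (n + 1) => p.1 < p.2 ∧ p ∉ A,
    alp K n p.1 p.2


open scoped TensorProduct

section Wiebe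

variable {K : Type*} [Field K] {n : ℕ}

/-- contraction of the second tensor factor against a functional -/
def ctr (lam : MvPolynomial (Fin n) K →ₗ[K] K) :
    MvPolynomial (Fin n) K ⊗[K] MvPolynomial (Fin n) K →ₗ[K] MvPolynomial (Fin n) K :=
  TensorProduct.lift ((LinearMap.lsmul K (MvPolynomial (Fin n) K)).flip.compl₂ lam)

lemma ctr_tmul (lam : MvPolynomial (Fin n) K →ₗ[K] K) (s t : MvPolynomial (Fin n) K) :
    ctr lam (s ⊗ₜ t) = lam t • s := by
  simp [ctr]

lemma ctr_add (lam mu : MvPolynomial (Fin n) K →ₗ[K] K)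
    (z : MvPolynomial (Fin n) K ⊗[K] MvPolynomial (Fin n) K) :
    ctr (lam + mu) z = ctr lam z + ctr mu z := by
  induction z using TensorProduct.induction_on with
  | zero => simp
  | tmul s t => simp [ctr_tmul, add_smul]
  | add x y hx hy => simp only [map_add, hx, hy]; ring

lemma ctr_smul (c : K) (lam : MvPolynomial (Fin n) K →ₗ[K] K)
    (z : MvPolynomial (Fin n) K ⊗[K] MvPolynomial (Fin n) K) :
    ctr (c • lam) z = c • ctr lam z := by
  induction z using TensorProduct.induction_on with
  | zero => simp
  | tmul s t => simp [ctr_tmul, mul_smul]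
  | add x y hx hy => simp only [map_add, hx, hy, smul_add]

lemma ctr_sum {ι : Type*} (s : Finset ι) (lam : ι → MvPolynomial (Fin n) K →ₗ[K] K)
    (z : MvPolynomial (Fin n) K ⊗[K] MvPolynomial (Fin n) K) :
    ctr (∑ i ∈ s, lam i) z = ∑ i ∈ s, ctr (lam i) z := by
  classical
  induction s using Finset.induction_on with
  | empty =>
    have := ctr_smul (0 : K) (0 : MvPolynomial (Fin n) K →ₗ[K] K) z
    simpa using this
  | insert a s ha ih => rw [Finset.sum_insert ha, Finset.sum_insert ha, ctr_add, ih]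

/-- left inclusion -/
abbrev tu (K : Type*) [Field K] (n : ℕ) : MvPolynomial (Fin n) K →ₐ[K] MvPolynomial (Fin n) K ⊗[K] MvPolynomial (Fin n) K :=
  Algebra.TensorProduct.includeLeft
/-- right inclusion -/
abbrev tv (K : Type*) [Field K] (n : ℕ) : MvPolynomial (Fin n) K →ₐ[K] MvPolynomial (Fin n) K ⊗[K] MvPolynomial (Fin n) K :=
  Algebra.TensorProduct.includeRight
/-- multiplication -/
abbrev tm (K : Type*) [Field K] (n : ℕ) : MvPolynomial (Fin n) K ⊗[K] MvPolynomial (Fin n) K →ₐ[K] MvPolynomial (Fin n) K :=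
  Algebra.TensorProduct.lmul' K

lemma ctr_tu (lam : MvPolynomial (Fin n) K →ₗ[K] K) (s : MvPolynomial (Fin n) K)
    (z : MvPolynomial (Fin n) K ⊗[K] MvPolynomial (Fin n) K) :
    ctr lam (tu K n s * z) = s * ctr lam z := by
  induction z using TensorProduct.induction_on with
  | zero => simp
  | tmul a b => simp [ctr_tmul]
  | add x y hx hy => simp only [mul_add, map_add, hx, hy]

lemma ctr_tv (lam : MvPolynomial (Fin n) K →ₗ[K] K) (s : MvPolynomial (Fin n) K)
    (z : MvPolynomial (Fin n) K ⊗[K] MvPolynomial (Fin n) K) :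
    ctr lam (tv K n s * z) = ctr (lam ∘ₗ LinearMap.mulLeft K s) z := by
  induction z using TensorProduct.induction_on with
  | zero => simp
  | tmul a b => simp [ctr_tmul]
  | add x y hx hy => simp only [mul_add, map_add, hx, hy]

lemma ctr_tv_zero (lam : MvPolynomial (Fin n) K →ₗ[K] K) (I : Ideal (MvPolynomial (Fin n) K))
    (hlam : ∀ s ∈ I, lam s = 0) (s : MvPolynomial (Fin n) K) (hs : s ∈ I)
    (z : MvPolynomial (Fin n) K ⊗[K] MvPolynomial (Fin n) K) :
    ctr lam (tv K n s * z) = 0 := by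
  have : lam ∘ₗ LinearMap.mulLeft K s = 0 := by
    ext1 t
    simp
    ext
    simp
    exact hlam _ (I.mul_mem_right _ hs)
  rw [ctr_tv, this]
  simpa using ctr_smul (0 : K) (0 : MvPolynomial (Fin n) K →ₗ[K] K) z

lemma exists_diff (g : MvPolynomial (Fin n) K) :
    ∃ d : Fin n → MvPolynomial (Fin n) K ⊗[K] MvPolynomial (Fin n) K,
      (tu K n g - tv K n g = ∑ j, d j * (tu K n (X j) - tv K n (X j))) ∧ ∀ j, tm K n (d j) = pderiv j g := by
  classical
  induction g using MvPolynomial.induction_on with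
  | C a =>
    refine ⟨0, ?_, by simp⟩
    have h1 := (tu K n).commutes a
    have h2 := (tv K n).commutes a
    rw [MvPolynomial.algebraMap_eq] at h1 h2
    rw [h1, h2]; simp
  | add p q hp hq =>
    obtain ⟨d, h, h'⟩ := hp
    obtain ⟨e, k, k'⟩ := hq
    refine ⟨d + e, ?_, fun j => by simp only [Pi.add_apply, map_add, h', k']⟩
    simp only [Pi.add_apply, map_add, add_mul, Finset.sum_add_distrib, ← h, ← k]
    ring
  | mul_X p i hp =>
    obtain ⟨d, h, h'⟩ := hp
    refine ⟨fun j => d j * tu K n (X i) + if j = i then tv K n p else 0, ?_, fun j => ?_⟩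
    · have : tu K n (p * X i) - tv K n (p * X i) = (tu K n p - tv K n p) * tu K n (X i)
        + tv K n p * (tu K n (X i) - tv K n (X i)) := by
        simp only [map_mul]; ring
      rw [this, h]
      simp only [add_mul, Finset.sum_add_distrib, ite_mul, zero_mul, Finset.sum_ite_eq',
        Finset.mem_univ, if_true, Finset.sum_mul]
      congr 1
      refine Finset.sum_congr rfl fun j _ => by ring
    · have h1 : ∀ s : MvPolynomial (Fin n) K, tm K n (tu K n s) = s := fun s => by simp
      have h2 : ∀ s : MvPolynomial (Fin n) K, tm K n (tv K n s) = s := fun s => by simp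
      rw [map_add, map_mul, h', h1, Derivation.leibniz, pderiv_X]
      by_cases hij : j = i
      · subst hij; rw [if_pos rfl, h2]; simp; ring
      · rw [if_neg hij]; simp [Ne.symm hij]; ring

lemma det_sub_mem {R : Type*} [CommRing R] {m : ℕ} (a b : Matrix (Fin m) (Fin m) R)
    (J : Ideal R) (h : ∀ i j, a i j - b i j ∈ J) : a.det - b.det ∈ J := by
  rw [← Ideal.Quotient.eq, RingHom.map_det, RingHom.map_det]
  congr 1
  ext i j
  exact Ideal.Quotient.eq.mpr (h i j)

lemma cramer_mem {R : Type*} [CommRing R] {m : ℕ} (a : Matrix (Fin m) (Fin m) R)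
    (x p : Fin m → R) (h : ∀ i, p i = ∑ j, a i j * x j) (j : Fin m) :
    a.det * x j ∈ Ideal.span (Set.range p) := by
  have h0 : a.mulVec x = p := by ext i; simp [Matrix.mulVec, dotProduct, h]
  have : a.adjugate.mulVec p = a.det • x := by
    rw [← h0, Matrix.mulVec_mulVec, Matrix.adjugate_mul, Matrix.smul_mulVec, Matrix.one_mulVec]
  have h2 := congrFun this j
  simp only [Pi.smul_apply, smul_eq_mul] at h2
  rw [← h2]
  simp only [Matrix.mulVec, dotProduct]
  exact Ideal.sum_mem _ fun i _ => Ideal.mul_mem_left _ _ (Ideal.subset_span ⟨i, rfl⟩)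

variable (p : Fin n → MvPolynomial (Fin n) K)

/-- functional on the quotient viewed upstairs -/
abbrev lft (I : Ideal (MvPolynomial (Fin n) K)) (nu : Module.Dual K (MvPolynomial (Fin n) K ⧸ I)) :
    MvPolynomial (Fin n) K →ₗ[K] K := nu ∘ₗ (Ideal.Quotient.mkₐ K I).toLinearMap

lemma lft_zero (I : Ideal (MvPolynomial (Fin n) K))
    (nu : Module.Dual K (MvPolynomial (Fin n) K ⧸ I)) (s) (hs : s ∈ I) : lft I nu s = 0 := by
  simp [lft, Ideal.Quotient.eq_zero_iff_mem.mpr hs]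

lemma ctr_shift (I : Ideal (MvPolynomial (Fin n) K)) (hI : I = Ideal.span (Set.range p))
    (a : Matrix (Fin n) (Fin n) (MvPolynomial (Fin n) K ⊗[K] MvPolynomial (Fin n) K))
    (ha : ∀ i, tu K n (p i) - tv K n (p i) = ∑ j, a i j * (tu K n (X j) - tv K n (X j)))
    (nu : Module.Dual K (MvPolynomial (Fin n) K ⧸ I))
    (s : MvPolynomial (Fin n) K) :
    ctr (lft _ nu ∘ₗ LinearMap.mulLeft K s) a.det - s * ctr (lft _ nu) a.det
      ∈ I := by
  have key : ∀ z ∈ Ideal.span (Set.range fun i => tu K n (p i) - tv K n (p i)),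
      ctr (lft _ nu) z ∈ I := by
    intro z hz
    induction hz using Submodule.span_induction with
    | zero => simp
    | add x y _ _ hx hy => rw [map_add]; exact Ideal.add_mem _ hx hy
    | mem x hx =>
      obtain ⟨i, rfl⟩ := hx
      have hi : p i ∈ I := hI ▸ Ideal.subset_span ⟨i, rfl⟩
      have h1 := ctr_tu (lft _ nu) (p i) 1
      have h2 := ctr_tv_zero (lft _ nu) _ (lft_zero _ nu) (p i) hi 1
      rw [mul_one] at h1 h2
      simp only [map_sub]
      rw [h1, h2, sub_zero]
      exact Ideal.mul_mem_right _ _ hi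
    | smul c x hx' hx =>
      clear hx
      rw [smul_eq_mul]
      induction hx' using Submodule.span_induction generalizing c with
      | zero => simp
      | add x y _ _ hx hy => rw [mul_add, map_add]; exact Ideal.add_mem _ (hx c) (hy c)
      | smul d x _ hx => rw [smul_eq_mul, ← mul_assoc]; exact hx _
      | mem x hx =>
        obtain ⟨i, rfl⟩ := hx
        have hi : p i ∈ I := hI ▸ Ideal.subset_span ⟨i, rfl⟩
        have h1 := ctr_tu (lft _ nu) (p i) c
        have h2 := ctr_tv_zero (lft _ nu) _ (lft_zero _ nu) (p i) hi c
        rw [mul_comm]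
        simp only [sub_mul, map_sub]
        rw [h1, h2, sub_zero]
        exact Ideal.mul_mem_right _ _ hi
  rw [← ctr_tv, ← ctr_tu, ← map_sub]
  apply key
  obtain ⟨d, hd, -⟩ := exists_diff s
  have : tv K n s * a.det - tu K n s * a.det = ∑ j, (- d j) * (a.det * (tu K n (X j) - tv K n (X j))) := by
    have : tv K n s * a.det - tu K n s * a.det = - ((tu K n s - tv K n s) * a.det) := by ring
    rw [this, hd, Finset.sum_mul, ← Finset.sum_neg_distrib]
    exact Finset.sum_congr rfl fun j _ => by ring
  rw [this]
  exact Ideal.sum_mem _ fun j _ => Ideal.mul_mem_left _ _ (cramer_mem a _ _ ha j)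

lemma nondeg (I : Ideal (MvPolynomial (Fin n) K)) (hI : I = Ideal.span (Set.range p))
    (a : Matrix (Fin n) (Fin n) (MvPolynomial (Fin n) K ⊗[K] MvPolynomial (Fin n) K))
    (ha : ∀ i, tu K n (p i) - tv K n (p i) = ∑ j, a i j * (tu K n (X j) - tv K n (X j)))
    (hfin : Module.Finite K (MvPolynomial (Fin n) K ⧸ I))
    (hloc : ∀ r : MvPolynomial (Fin n) K ⧸ I, IsUnit r ∨ IsNilpotent r)
    (hJ : tm K n a.det ∉ I)
    (nu : Module.Dual K (MvPolynomial (Fin n) K ⧸ I))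
    (hnu : ctr (lft _ nu) a.det ∈ I) : nu = 0 := by
  classical
  by_contra hne
  let N : Submodule K (Module.Dual K (MvPolynomial (Fin n) K ⧸ I)) :=
    { carrier := {nu | ctr (lft I nu) a.det ∈ I}
      add_mem' := by
        intro x y hx hy
        have : lft I (x + y) = lft I x + lft I y := LinearMap.add_comp _ _ _
        simp only [Set.mem_ofPred_eq] at *
        rw [this, ctr_add]; exact I.add_mem hx hy
      zero_mem' := by
        have h : lft I 0 = (0 : K) • (0 : MvPolynomial (Fin n) K →ₗ[K] K) := by
          rw [zero_smul]; exact LinearMap.zero_comp _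
        simp only [Set.mem_ofPred_eq]
        rw [h, ctr_smul]; simp
      smul_mem' := by
        intro c x hx
        have : lft I (c • x) = c • lft I x := LinearMap.smul_comp _ _ _
        simp only [Set.mem_ofPred_eq] at *
        rw [this, ctr_smul, MvPolynomial.smul_eq_C_mul]
        exact I.mul_mem_left _ hx }
  have hN : ∀ nu, nu ∈ N ↔ ctr (lft I nu) a.det ∈ I := fun _ => Iff.rfl
  have hmul : ∀ nu ∈ N, ∀ r, nu ∘ₗ LinearMap.mulLeft K r ∈ N := by
    intro nu hnu r
    obtain ⟨s, rfl⟩ := Ideal.Quotient.mk_surjective r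
    have h := ctr_shift p I hI a ha nu s
    rw [hN] at hnu ⊢
    have h2 : lft I (nu ∘ₗ LinearMap.mulLeft K (Ideal.Quotient.mk I s))
      = lft I nu ∘ₗ LinearMap.mulLeft K s := by
      apply LinearMap.ext; intro t; simp
    rw [h2]
    exact (Submodule.sub_mem_iff_left _ (I.mul_mem_left _ hnu)).mp h
  have htr : Algebra.trace K (MvPolynomial (Fin n) K ⧸ I) ∈ N := by
    rw [← Subspace.dualCoannihilator_dualAnnihilator_eq (W := N), Submodule.mem_dualAnnihilator]
    intro r hr
    rw [Submodule.mem_dualCoannihilator] at hr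
    rcases hloc r with hu | hn
    · exfalso
      apply hne
      obtain ⟨u, rfl⟩ := hu
      apply LinearMap.ext
      intro s
      have := hr _ (hmul nu hnu (s * (↑u⁻¹)))
      rw [LinearMap.comp_apply, LinearMap.mulLeft_apply, mul_assoc, Units.inv_mul, mul_one] at this
      rw [this]; rfl
    · rw [Algebra.trace_apply]
      exact (LinearMap.isNilpotent_trace_of_isNilpotent (hn.map (Algebra.lmul K _))).eq_zero
  apply hJ
  let e := Module.finBasis K (MvPolynomial (Fin n) K ⧸ I)
  choose s hs using fun k => Ideal.Quotient.mk_surjective (e k)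
  have h1 : ∀ z : MvPolynomial (Fin n) K ⊗[K] MvPolynomial (Fin n) K,
      Ideal.Quotient.mk I (tm K n z) = ∑ k, Ideal.Quotient.mk I (s k * ctr (lft I (e.coord k)) z) := by
    intro z
    induction z using TensorProduct.induction_on with
    | zero => simp
    | add x y hx hy => simp only [map_add, hx, hy, mul_add, Finset.sum_add_distrib]
    | tmul x y =>
      have := e.sum_repr (Ideal.Quotient.mk I y)
      have h3 : Ideal.Quotient.mk I (tm K n (x ⊗ₜ[K] y)) = Ideal.Quotient.mk I x * Ideal.Quotient.mk I y := by
        simp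
      rw [h3, ← this, Finset.mul_sum]
      refine Finset.sum_congr rfl fun k _ => ?_
      rw [ctr_tmul, ← hs, MvPolynomial.smul_eq_C_mul]
      have : ∀ c : K, ∀ r : MvPolynomial (Fin n) K ⧸ I, c • r = Ideal.Quotient.mk I (C c) * r := by
        intro c r
        obtain ⟨r, rfl⟩ := Ideal.Quotient.mk_surjective r
        rw [← map_mul, ← MvPolynomial.smul_eq_C_mul]; rfl
      rw [this]
      simp [lft]
      ring
  have h2 : lft I (Algebra.trace K _) =
      ∑ k, lft I (e.coord k) ∘ₗ LinearMap.mulLeft K (s k) := by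
    apply LinearMap.ext
    intro t
    simp only [LinearMap.sum_apply]
    simp [Algebra.trace_eq_matrix_trace e, Matrix.trace, Algebra.leftMulMatrix_eq_repr_mul, hs, mul_comm]
  have h4 := (hN _).mp htr
  rw [h2, ctr_sum] at h4
  rw [← Ideal.Quotient.eq_zero_iff_mem, map_sum] at h4
  rw [← Ideal.Quotient.eq_zero_iff_mem, h1, ← h4]
  refine Finset.sum_congr rfl fun k _ => ?_
  exact (Ideal.Quotient.eq.mpr (ctr_shift p I hI a ha (e.coord k) (s k))).symm

theorem wiebe (f : Fin n → MvPolynomial (Fin n) K)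
    (B : Matrix (Fin n) (Fin n) (MvPolynomial (Fin n) K))
    (hp : ∀ i, p i = ∑ k, B i k * f k)
    (hfin : Module.Finite K (MvPolynomial (Fin n) K ⧸ Ideal.span (Set.range p)))
    (hloc : ∀ r : MvPolynomial (Fin n) K ⧸ Ideal.span (Set.range p), IsUnit r ∨ IsNilpotent r)
    (hJ : (Matrix.of fun i j => pderiv j (p i)).det ∉ Ideal.span (Set.range p))
    (g : MvPolynomial (Fin n) K) (hg : B.det * g ∈ Ideal.span (Set.range p)) :
    g ∈ Ideal.span (Set.range f) := by
  classical
  choose d hd hd' using exists_diff (K := K) (n := n)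
  set I := Ideal.span (Set.range p) with hI
  set F := Ideal.span (Set.range f) with hF
  have hIF : I ≤ F := by
    rw [hI, Ideal.span_le]
    rintro _ ⟨i, rfl⟩
    rw [hp]
    exact Ideal.sum_mem _ fun k _ => Ideal.mul_mem_left _ _ (Ideal.subset_span ⟨k, rfl⟩)
  have hFI : ∀ x ∈ F, B.det * x ∈ I := by
    intro x h1
    rw [hF, Ideal.span, Submodule.mem_span_range_iff_exists_fun] at h1
    obtain ⟨w, hw⟩ := h1
    rw [← hw, Finset.mul_sum]
    refine Ideal.sum_mem _ fun k _ => ?_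
    have := I.mul_mem_left (w k) (cramer_mem B f p hp k)
    rw [smul_eq_mul]
    convert this using 1
    ring
  let c : Matrix (Fin n) (Fin n) (MvPolynomial (Fin n) K ⊗[K] MvPolynomial (Fin n) K) :=
    Matrix.of fun k j => d (f k) j
  let a : Matrix (Fin n) (Fin n) (MvPolynomial (Fin n) K ⊗[K] MvPolynomial (Fin n) K) :=
    Matrix.of fun i j => ∑ k, (tu K n (B i k) * d (f k) j + tv K n (f k) * d (B i k) j)
  have ha : ∀ i, tu K n (p i) - tv K n (p i) = ∑ j, a i j * (tu K n (X j) - tv K n (X j)) := by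
    intro i
    have h1 : tu K n (p i) - tv K n (p i)
        = ∑ k, (tu K n (B i k) * (tu K n (f k) - tv K n (f k)) + tv K n (f k) * (tu K n (B i k) - tv K n (B i k))) := by
      rw [hp, map_sum, map_sum, ← Finset.sum_sub_distrib]
      refine Finset.sum_congr rfl fun k _ => ?_
      simp only [map_mul]; ring
    rw [h1]
    simp only [a, Matrix.of_apply, Finset.sum_mul]
    rw [Finset.sum_comm]
    refine Finset.sum_congr rfl fun k _ => ?_
    rw [hd (f k), hd (B i k), Finset.mul_sum, Finset.mul_sum, ← Finset.sum_add_distrib]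
    refine Finset.sum_congr rfl fun j _ => ?_
    ring
  have hm : tm K n a.det = (Matrix.of fun i j => pderiv j (p i)).det := by
    rw [AlgHom.map_det]
    congr 1
    ext1 i j
    have h1 : ∀ s : MvPolynomial (Fin n) K, tm K n (tu K n s) = s := fun s => by simp
    have h2 : ∀ s : MvPolynomial (Fin n) K, tm K n (tv K n s) = s := fun s => by simp
    simp only [AlgHom.mapMatrix_apply, Matrix.map_apply, a, Matrix.of_apply]
    rw [hp, map_sum, map_sum]
    refine Finset.sum_congr rfl fun k _ => ?_
    rw [map_add, map_mul, map_mul, h1, h2, hd', hd', Derivation.leibniz]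
    rfl
  have hdet : a.det - tu K n B.det * c.det ∈ Ideal.span (Set.range fun k => tv K n (f k)) := by
    rw [AlgHom.map_det, ← Matrix.det_mul]
    apply det_sub_mem
    intro i j
    simp only [AlgHom.mapMatrix_apply, Matrix.map_apply, a, c, Matrix.of_apply, Matrix.mul_apply]
    rw [← Finset.sum_sub_distrib]
    refine Ideal.sum_mem _ fun k _ => ?_
    rw [add_sub_cancel_left]
    exact Ideal.mul_mem_right _ _ (Ideal.subset_span ⟨k, rfl⟩)
  have hctr : ∀ nu : Module.Dual K (MvPolynomial (Fin n) K ⧸ F),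
      ctr (lft F nu) a.det = B.det * ctr (lft F nu) c.det := by
    intro nu
    rw [← ctr_tu, ← sub_eq_zero, ← map_sub]
    revert hdet
    generalize a.det - tu K n B.det * c.det = z
    intro hz
    rw [Ideal.span, Submodule.mem_span_range_iff_exists_fun] at hz
    obtain ⟨w, rfl⟩ := hz
    rw [map_sum]
    refine Finset.sum_eq_zero fun k _ => ?_
    rw [smul_eq_mul, mul_comm]
    exact ctr_tv_zero _ F (lft_zero F nu) _ (Ideal.subset_span ⟨k, rfl⟩) _
  have hinj : ∀ nu : Module.Dual K (MvPolynomial (Fin n) K ⧸ F),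
      B.det * ctr (lft F nu) c.det ∈ I → nu = 0 := by
    intro nu h
    rw [← hctr] at h
    have h0 := nondeg p I hI a ha hfin hloc (by rw [hm]; exact hJ)
      (nu ∘ₗ (Ideal.Quotient.factorₐ K hIF).toLinearMap) (by
        have : lft I (nu ∘ₗ (Ideal.Quotient.factorₐ K hIF).toLinearMap)
          = lft F nu := by
          apply LinearMap.ext; intro t; rfl
        rw [this]; exact h)
    apply LinearMap.ext
    intro r
    obtain ⟨s, rfl⟩ := Ideal.Quotient.mk_surjective r
    have := LinearMap.congr_fun h0 (Ideal.Quotient.mk I s)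
    simpa using this
  have hfinF : Module.Finite K (MvPolynomial (Fin n) K ⧸ F) :=
    Module.Finite.of_surjective (Ideal.Quotient.factorₐ K hIF).toLinearMap
      (Ideal.Quotient.factor_surjective hIF)
  let Th : Module.Dual K (MvPolynomial (Fin n) K ⧸ F) →ₗ[K] (MvPolynomial (Fin n) K ⧸ F) :=
    { toFun := fun nu => Ideal.Quotient.mkₐ K F (ctr (lft F nu) c.det)
      map_add' := by
        intro x y
        have : lft F (x + y) = lft F x + lft F y := LinearMap.add_comp _ _ _
        rw [this, ctr_add, map_add]
      map_smul' := by
        intro k x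
        have : lft F (k • x) = k • lft F x := LinearMap.smul_comp _ _ _
        rw [this, ctr_smul, map_smul]; rfl }
  have hTinj : Function.Injective Th := by
    rw [injective_iff_map_eq_zero]
    intro nu h
    apply hinj
    have h1 : ctr (lft F nu) c.det ∈ F := Ideal.Quotient.eq_zero_iff_mem.mp h
    exact hFI _ h1
  have hTsurj : Function.Surjective Th :=
    (LinearMap.injective_iff_surjective_of_finrank_eq_finrank Subspace.dual_finrank_eq).mp hTinj
  obtain ⟨nu, hnu⟩ := hTsurj (Ideal.Quotient.mk F g)
  have h1 : ctr (lft F nu) c.det - g ∈ F := Ideal.Quotient.eq.mp hnu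
  have h2 : B.det * (ctr (lft F nu) c.det - g) ∈ I := by
    exact hFI _ h1
  have h3 : nu = 0 := hinj nu (by
    rw [mul_sub] at h2
    exact (Submodule.sub_mem_iff_left _ hg).mp h2)
  rw [h3] at hnu
  rw [← Ideal.Quotient.eq_zero_iff_mem, ← hnu, map_zero]

end Wiebe

section Lin

variable {K : Type*} [Field K] {n : ℕ}

lemma varx_zero : varx K n 0 = 0 := by simp [varx]

lemma varx_succ (k : Fin n) : varx K n k.succ = X k := by
  simp [varx]

lemma varx_inj {i j : Fin (n + 1)} (h : varx K n i = varx K n j) : i = j := by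
  induction i using Fin.cases with
  | zero =>
    induction j using Fin.cases with
    | zero => rfl
    | succ j => rw [varx_zero, varx_succ] at h; exact absurd h.symm (X_ne_zero j)
  | succ i =>
    induction j using Fin.cases with
    | zero => rw [varx_zero, varx_succ] at h; exact absurd h (X_ne_zero i)
    | succ j => rw [varx_succ, varx_succ] at h; rw [X_injective h]

variable (K) in
/-- the linear form up to sign -/
def lin (p : Fin (n + 1) × Fin (n + 1)) : MvPolynomial (Fin n) K := varx K n p.2 - varx K n p.1

lemma lin_assoc (p : Fin (n + 1) × Fin (n + 1)) : Associated (lin K p) (alp K n p.1 p.2) := by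
  unfold alp lin
  split_ifs with h
  · rw [h, varx_zero, sub_zero]
  · rw [← neg_sub]; exact Associated.neg_left (Associated.refl _)

variable (K) in
/-- substitution `x_j := x_i` -/
def phi (p : Fin (n + 1) × Fin (n + 1)) : MvPolynomial (Fin n) K →ₐ[K] MvPolynomial (Fin n) K :=
  aeval fun k => varx K n (if k.succ = p.2 then p.1 else k.succ)

lemma phi_varx (p : Fin (n + 1) × Fin (n + 1)) (hp : p.1 < p.2) (k : Fin (n + 1)) :
    phi K p (varx K n k) = varx K n (if k = p.2 then p.1 else k) := by
  induction k using Fin.cases with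
  | zero => rw [varx_zero, map_zero, if_neg (Fin.ne_zero_of_lt hp).symm, varx_zero]
  | succ k => rw [varx_succ]; simp [phi]

lemma phi_lin (p : Fin (n + 1) × Fin (n + 1)) (hp : p.1 < p.2) : phi K p (lin K p) = 0 := by
  rw [lin, map_sub, phi_varx p hp, phi_varx p hp]; simp

lemma phi_lin_ne (p q : Fin (n + 1) × Fin (n + 1)) (hp : p.1 < p.2) (hq : q.1 < q.2)
    (h : phi K p (lin K q) = 0) : p = q := by
  rw [lin, map_sub, phi_varx p hp, phi_varx p hp, sub_eq_zero] at h
  have h := varx_inj h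
  rcases p with ⟨i, j⟩
  rcases q with ⟨k, l⟩
  simp only at *
  rw [Prod.mk.injEq]
  split_ifs at h with h1 h2 h2 <;> subst_vars
  · exact absurd hq (lt_irrefl _)
  · exact ⟨rfl, rfl⟩
  · exact absurd (hp.trans hq) (lt_irrefl _)
  · exact absurd hq (lt_irrefl _)

lemma lin_dvd (p : Fin (n + 1) × Fin (n + 1)) (g : MvPolynomial (Fin n) K)
    (h : phi K p g = 0) : lin K p ∣ g := by
  rw [← Ideal.mem_span_singleton, ← Ideal.Quotient.eq_zero_iff_mem]
  have : (Ideal.Quotient.mkₐ K (Ideal.span {lin K p})).comp (phi K p)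
      = Ideal.Quotient.mkₐ K (Ideal.span {lin K p}) := by
    apply MvPolynomial.algHom_ext
    intro k
    simp only [AlgHom.comp_apply, phi, aeval_X]
    split_ifs with hk
    · rw [← varx_succ, hk]
      refine (Ideal.Quotient.eq.mpr ?_).symm
      exact Ideal.subset_span rfl
    · rw [varx_succ]
  have h2 := DFunLike.congr_fun this g
  rw [AlgHom.comp_apply, h, map_zero] at h2
  exact h2.symm

lemma lin_dvd_iff (p : Fin (n + 1) × Fin (n + 1)) (hp : p.1 < p.2) (g : MvPolynomial (Fin n) K) :
    lin K p ∣ g ↔ phi K p g = 0 := by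
  refine ⟨?_, lin_dvd p g⟩
  rintro ⟨c, rfl⟩
  rw [map_mul, phi_lin p hp, zero_mul]

lemma lin_prime (p : Fin (n + 1) × Fin (n + 1)) (hp : p.1 < p.2) : Prime (lin K p) := by
  refine ⟨?_, ?_, ?_⟩
  · intro h
    exact hp.ne' (varx_inj (sub_eq_zero.mp h))
  · intro h
    have := h.map (phi K p)
    rw [phi_lin p hp] at this
    exact not_isUnit_zero this
  · intro a b
    rw [lin_dvd_iff p hp, lin_dvd_iff p hp, lin_dvd_iff p hp, map_mul, mul_eq_zero]
    exact id

lemma lin_relPrime (p q : Fin (n + 1) × Fin (n + 1)) (hp : p.1 < p.2) (hq : q.1 < q.2)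
    (h : p ≠ q) : IsRelPrime (lin K p) (lin K q) := by
  rw [(lin_prime p hp).irreducible.isRelPrime_iff_not_dvd]
  intro hd
  exact h (phi_lin_ne p q hp hq ((lin_dvd_iff p hp _).mp hd))

lemma prod_lin_dvd (A : Finset (Fin (n + 1) × Fin (n + 1))) (hA : ∀ p ∈ A, p.1 < p.2)
    (g : MvPolynomial (Fin n) K) (h : ∀ p ∈ A, lin K p ∣ g) : ∏ p ∈ A, lin K p ∣ g := by
  refine Finset.prod_dvd_of_isRelPrime ?_ h
  intro p hp q hq hpq
  exact lin_relPrime p q (hA p hp) (hA q hq) hpq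

/-- all pairs `i < j` -/
def allP (n : ℕ) : Finset (Fin (n + 1) × Fin (n + 1)) := Finset.univ.filter fun p => p.1 < p.2

lemma det_varx : (Matrix.vandermonde (varx K n)).det = ∏ p ∈ allP n, lin K p := by
  rw [Matrix.det_vandermonde, allP, Finset.prod_filter, ← Finset.univ_product_univ,
    Finset.prod_product]
  refine Finset.prod_congr rfl fun i _ => ?_
  rw [← Finset.prod_filter]
  refine Finset.prod_congr ?_ fun j _ => rfl
  ext j; simp

lemma det_eta : (Matrix.of fun k i : Fin n => (X i : MvPolynomial (Fin n) K) ^ ((k : ℕ) + 1)).det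
    = ∏ p ∈ allP n, lin K p := by
  rw [← det_varx, Matrix.det_succ_row_zero, Finset.sum_eq_single 0]
  · rw [← Matrix.det_transpose]
    simp only [Matrix.vandermonde_apply, Fin.val_zero, pow_zero, one_mul]
    congr 1
  · intro j _ hj
    have : (j : ℕ) ≠ 0 := fun h => hj (Fin.ext h)
    simp [Matrix.vandermonde_apply, varx_zero, this]
  · simp

/-- Vandermonde in `n` variables divides alternating-like polynomials -/
lemma vand_dvd (g : MvPolynomial (Fin n) K)
    (h : ∀ i j : Fin n, i < j → lin K (i.succ, j.succ) ∣ g) :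
    (Matrix.vandermonde (X : Fin n → MvPolynomial (Fin n) K)).det ∣ g := by
  classical
  have : (Matrix.vandermonde (X : Fin n → MvPolynomial (Fin n) K)).det =
      ∏ p ∈ (Finset.univ.filter fun p : Fin n × Fin n => p.1 < p.2), 
        lin K (p.1.succ, p.2.succ) := by
    rw [Matrix.det_vandermonde, Finset.prod_filter, ← Finset.univ_product_univ,
      Finset.prod_product]
    refine Finset.prod_congr rfl fun i _ => ?_
    rw [← Finset.prod_filter]
    refine Finset.prod_congr ?_ fun j _ => by simp [lin, varx_succ]
    ext j; simp
  rw [this]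
  refine Finset.prod_dvd_of_isRelPrime ?_ ?_
  · intro p hp q hq hpq
    simp only [Finset.coe_filter, Finset.mem_univ, true_and, Set.mem_ofPred_eq] at hp hq
    refine lin_relPrime _ _ (by simpa using hp) (by simpa using hq) ?_
    intro h
    apply hpq
    simp only [Prod.mk.injEq, Fin.succ_inj] at h
    exact Prod.ext h.1 h.2
  · intro p hp
    simp only [Finset.mem_filter, Finset.mem_univ, true_and] at hp
    exact h _ _ hp

end Lin

section Coinv

variable {K : Type*} [Field K] {n : ℕ}

/-- antisymmetrization -/
def alt (h : MvPolynomial (Fin n) K) : MvPolynomial (Fin n) K :=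
  ∑ s : Equiv.Perm (Fin n), (((Equiv.Perm.sign s : ℤˣ) : ℤ) : MvPolynomial (Fin n) K) * rename s h

lemma rename_alt (t : Equiv.Perm (Fin n)) (h : MvPolynomial (Fin n) K) :
    rename t (alt h) = (((Equiv.Perm.sign t : ℤˣ) : ℤ) : MvPolynomial (Fin n) K) * alt h := by
  unfold alt
  rw [map_sum, Finset.mul_sum]
  refine Fintype.sum_equiv (Equiv.mulLeft t) _ _ fun s => ?_
  have h1 : (((Equiv.Perm.sign t : ℤˣ) : ℤ) : MvPolynomial (Fin n) K)
      * (((Equiv.Perm.sign t : ℤˣ) : ℤ) : MvPolynomial (Fin n) K) = 1 := by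
    rw [← Int.cast_mul, ← Units.val_mul, Int.units_mul_self]; simp
  simp only [map_mul, map_intCast, rename_rename, Equiv.coe_mulLeft, Equiv.Perm.coe_mul,
    Units.val_mul, Int.cast_mul]
  rw [← mul_assoc, ← mul_assoc, h1, one_mul]

lemma vand_dvd_alt [CharZero K] (h : MvPolynomial (Fin n) K) :
    (Matrix.vandermonde (X : Fin n → MvPolynomial (Fin n) K)).det ∣ alt h := by
  apply vand_dvd
  intro i j hij
  apply lin_dvd
  have h1 := congrArg (phi K (i.succ, j.succ)) (rename_alt (Equiv.swap i j) h)
  have h2 : (phi K (i.succ, j.succ)).comp (rename (Equiv.swap i j)) = phi K (i.succ, j.succ) := by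
    apply MvPolynomial.algHom_ext
    intro k
    simp only [AlgHom.comp_apply, rename_X, phi, aeval_X, Fin.succ_inj]
    rw [Equiv.swap_apply_def]
    split_ifs <;> simp_all
  have h3 := DFunLike.congr_fun h2 (alt h)
  rw [AlgHom.comp_apply] at h3
  rw [h3, Equiv.Perm.sign_swap hij.ne] at h1
  simp only [Units.val_neg, Units.val_one, Int.cast_neg, Int.cast_one, neg_mul, one_mul,
    map_neg] at h1
  exact self_eq_neg.mp h1

lemma alt_vand : alt (Matrix.vandermonde (X : Fin n → MvPolynomial (Fin n) K)).det
    = (Nat.factorial n : MvPolynomial (Fin n) K) *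
      (Matrix.vandermonde (X : Fin n → MvPolynomial (Fin n) K)).det := by
  unfold alt
  have : ∀ s : Equiv.Perm (Fin n), (((Equiv.Perm.sign s : ℤˣ) : ℤ) : MvPolynomial (Fin n) K) *
      rename s (Matrix.vandermonde (X : Fin n → MvPolynomial (Fin n) K)).det =
      (Matrix.vandermonde (X : Fin n → MvPolynomial (Fin n) K)).det := by
    intro s
    have h2 : rename s (Matrix.vandermonde (X : Fin n → MvPolynomial (Fin n) K)).det
      = (((Equiv.Perm.sign s : ℤˣ) : ℤ) : MvPolynomial (Fin n) K) *
        (Matrix.vandermonde (X : Fin n → MvPolynomial (Fin n) K)).det := by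
      rw [← Matrix.det_permute, AlgHom.map_det]
      congr 1
      ext1 i j
      simp [Matrix.vandermonde_apply]
    have h1 : (((Equiv.Perm.sign s : ℤˣ) : ℤ) : MvPolynomial (Fin n) K)
        * (((Equiv.Perm.sign s : ℤˣ) : ℤ) : MvPolynomial (Fin n) K) = 1 := by
      rw [← Int.cast_mul, ← Units.val_mul, Int.units_mul_self]; simp
    rw [h2, ← mul_assoc, h1, one_mul]
  rw [Finset.sum_congr rfl fun s _ => this s]
  simp [Fintype.card_perm]

lemma vand_ne : (Matrix.vandermonde (X : Fin n → MvPolynomial (Fin n) K)).det ≠ 0 := by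
  rw [Matrix.det_vandermonde_ne_zero_iff]
  exact X_injective

lemma vand_notMem [CharZero K] :
    (Matrix.vandermonde (X : Fin n → MvPolynomial (Fin n) K)).det ∉ coinvIdeal K n := by
  intro hV
  have key : ∀ z ∈ coinvIdeal K n, ∀ c, ∃ w, constantCoeff w = 0 ∧
      alt (c * z) = (Matrix.vandermonde (X : Fin n → MvPolynomial (Fin n) K)).det * w := by
    intro z hz
    unfold coinvIdeal at hz
    induction hz using Submodule.span_induction with
    | zero => intro c; exact ⟨0, by simp, by simp [alt]⟩
    | add x y _ _ hx hy =>
      intro c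
      obtain ⟨w, h1, h2⟩ := hx c
      obtain ⟨w', h1', h2'⟩ := hy c
      refine ⟨w + w', by simp [h1, h1'], ?_⟩
      rw [mul_add, mul_add, ← h2, ← h2']
      simp [alt, mul_add, Finset.sum_add_distrib]
    | smul d x _ hx =>
      intro c
      rw [smul_eq_mul, ← mul_assoc]
      exact hx _
    | mem x hx =>
      intro c
      obtain ⟨w, hw⟩ := vand_dvd_alt c
      refine ⟨w * x, by rw [map_mul, hx.2, mul_zero], ?_⟩
      rw [← mul_assoc, ← hw]
      unfold alt
      rw [Finset.sum_mul]
      refine Finset.sum_congr rfl fun s _ => ?_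
      rw [map_mul, hx.1 s, mul_assoc]
  obtain ⟨w, h1, h2⟩ := key _ hV 1
  rw [one_mul, alt_vand, mul_comm] at h2
  have h3 := mul_left_cancel₀ vand_ne h2
  have h4 := congrArg constantCoeff h3
  rw [h1, map_natCast] at h4
  exact Nat.factorial_ne_zero n (by exact_mod_cast h4)

variable (K n) in
/-- the power sums `p_1, …, p_n` -/
def pw (i : Fin n) : MvPolynomial (Fin n) K := psum (Fin n) K ((i : ℕ) + 1)

lemma esymm_mem [CharZero K] (k : ℕ) (hk : 0 < k) (hkn : k ≤ n) :
    esymm (Fin n) K k ∈ Ideal.span (Set.range (pw K n)) := by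
  have h := mul_esymm_eq_sum (Fin n) K k
  have h2 : (k : MvPolynomial (Fin n) K) * esymm (Fin n) K k ∈ Ideal.span (Set.range (pw K n)) := by
    rw [h]
    refine Ideal.mul_mem_left _ _ (Ideal.sum_mem _ fun a ha => Ideal.mul_mem_left _ _ ?_)
    rw [Finset.mem_filter] at ha
    have ha1 := Finset.HasAntidiagonal.mem_antidiagonal.mp ha.1
    have ha2 := ha.2
    refine Ideal.subset_span ⟨⟨a.2 - 1, by omega⟩, ?_⟩
    unfold pw
    congr 1
    simp only
    omega
  have h3 := Ideal.mul_mem_left _ (C ((k : K)⁻¹)) h2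
  rw [← mul_assoc, ← map_natCast (C (R := K) (σ := Fin n)) k, ← C_mul,
    inv_mul_cancel₀ (by exact_mod_cast hk.ne'), C_1, one_mul] at h3
  exact h3

lemma coinv_eq [CharZero K] : coinvIdeal K n = Ideal.span (Set.range (pw K n)) := by
  apply le_antisymm
  · unfold coinvIdeal
    rw [Ideal.span_le]
    rintro f ⟨hs, h0⟩
    obtain ⟨g, hg⟩ := esymmAlgHom_fin_surjective K (le_refl n) ⟨f, hs⟩
    have hg' : aeval (fun i : Fin n => esymm (Fin n) K ((i : ℕ) + 1)) g = f := by
      rw [← esymmAlgHom_apply, hg]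
    let I := Ideal.span (Set.range (pw K n))
    have h1 : (Ideal.Quotient.mkₐ K I).comp (aeval fun i : Fin n => esymm (Fin n) K ((i : ℕ) + 1))
      = ((Algebra.ofId K (MvPolynomial (Fin n) K ⧸ I)).comp (aeval (fun _ => (0 : K)))).comp
        (aeval fun i : Fin n => esymm (Fin n) K ((i : ℕ) + 1)) := by
      apply MvPolynomial.algHom_ext
      intro k
      simp only [AlgHom.comp_apply, aeval_X]
      have e1 : Ideal.Quotient.mkₐ K I (esymm (Fin n) K ((k : ℕ) + 1)) = 0 :=
        Ideal.Quotient.eq_zero_iff_mem.mpr (esymm_mem _ (by omega) (by omega))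
      have e2 : aeval (fun _ => (0 : K)) (esymm (Fin n) K ((k : ℕ) + 1)) = 0 := by
        rw [esymm, map_sum]
        refine Finset.sum_eq_zero fun t ht => ?_
        rw [map_prod]
        rw [Finset.mem_powersetCard] at ht
        simp only [aeval_X, Finset.prod_const]
        rw [ht.2, zero_pow (by omega)]
      rw [e1, e2, map_zero]
    have h2 := DFunLike.congr_fun h1 g
    simp only [AlgHom.comp_apply] at h2
    rw [hg'] at h2
    have h3 : aeval (fun _ => (0 : K)) f = 0 := by
      rw [aeval_zero', h0, map_zero]
    rw [h3, map_zero] at h2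
    exact Ideal.Quotient.eq_zero_iff_mem.mp h2
  · rw [Ideal.span_le]
    rintro _ ⟨i, rfl⟩
    refine Ideal.subset_span ⟨psum_isSymmetric _ _ _, ?_⟩
    simp [pw, psum]

lemma X_pow_mem [CharZero K] (i : Fin n) :
    (X i : MvPolynomial (Fin n) K) ^ n ∈ Ideal.span (Set.range (pw K n)) := by
  have h := congrArg (Polynomial.eval (-X i)) (MvPolynomial.prod_C_add_X_eq_sum_esymm K (Fin n))
  rw [Polynomial.eval_prod, Finset.prod_eq_zero (Finset.mem_univ i) (by simp),
    Finset.sum_range_succ', Polynomial.eval_add, Polynomial.eval_finsetSum] at h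
  simp only [Fintype.card_fin, esymm_zero, Polynomial.eval_mul, Polynomial.eval_C,
    Polynomial.eval_pow, Polynomial.eval_X, map_one, one_mul, Nat.sub_zero, Polynomial.eval_one] at h
  have h2 : (-X i : MvPolynomial (Fin n) K) ^ n ∈ Ideal.span (Set.range (pw K n)) := by
    rw [← neg_mem_iff, ← eq_neg_of_add_eq_zero_left h.symm]
    refine Ideal.sum_mem _ fun k hk => Ideal.mul_mem_right _ _ (esymm_mem _ (by omega) ?_)
    have := Finset.mem_range.mp hk
    omega
  rw [neg_pow] at h2
  have h3 := Ideal.mul_mem_left _ ((-1) ^ n) h2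
  rw [← mul_assoc, ← mul_pow] at h3
  simpa using h3

lemma quot_decomp [CharZero K] (r : MvPolynomial (Fin n) K ⧸ Ideal.span (Set.range (pw K n))) :
    ∃ c : K, IsNilpotent (r - algebraMap K _ c) := by
  obtain ⟨g, rfl⟩ := Ideal.Quotient.mk_surjective r
  induction g using MvPolynomial.induction_on with
  | C a => exact ⟨a, by
      have : Ideal.Quotient.mk (Ideal.span (Set.range (pw K n))) (C a) = algebraMap K _ a := rfl
      rw [this, sub_self]; exact IsNilpotent.zero⟩
  | add p q hp hq =>
    obtain ⟨c, hc⟩ := hp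
    obtain ⟨d, hd⟩ := hq
    refine ⟨c + d, ?_⟩
    have := (Commute.all _ _).isNilpotent_add hc hd
    rw [map_add, map_add, add_sub_add_comm]
    exact this
  | mul_X p i _ =>
    refine ⟨0, ?_⟩
    rw [map_zero, sub_zero, map_mul]
    refine (Commute.all _ _).isNilpotent_mul_left ⟨n, ?_⟩
    rw [← map_pow]
    exact Ideal.Quotient.eq_zero_iff_mem.mpr (X_pow_mem i)

lemma quot_loc [CharZero K] (r : MvPolynomial (Fin n) K ⧸ Ideal.span (Set.range (pw K n))) :
    IsUnit r ∨ IsNilpotent r := by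
  obtain ⟨c, hc⟩ := quot_decomp r
  by_cases h : c = 0
  · right; simpa [h] using hc
  · left
    have h1 : IsUnit (algebraMap K (MvPolynomial (Fin n) K ⧸ Ideal.span (Set.range (pw K n))) c) :=
      (IsUnit.mk0 c h).map _
    have := IsNilpotent.isUnit_add_left_of_commute hc h1 (Commute.all _ _)
    simpa using this

lemma quot_fin [CharZero K] :
    Module.Finite K (MvPolynomial (Fin n) K ⧸ Ideal.span (Set.range (pw K n))) := by
  have : Algebra.IsIntegral K (MvPolynomial (Fin n) K ⧸ Ideal.span (Set.range (pw K n))) := by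
    constructor
    intro r
    obtain ⟨c, hc⟩ := quot_decomp r
    have h1 : IsIntegral K (r - algebraMap K _ c) := by
      obtain ⟨m, hm⟩ := hc
      exact IsIntegral.of_pow (n := m + 1) (by omega) (by rw [pow_succ, hm, zero_mul]; exact isIntegral_zero)
    have := h1.add (isIntegral_algebraMap (x := c))
    simpa using this
  exact Algebra.IsIntegral.finite

lemma jac_notMem [CharZero K] :
    (Matrix.of fun i j => pderiv j (pw K n i)).det ∉ Ideal.span (Set.range (pw K n)) := by
  have h : (Matrix.of fun i j => pderiv j (pw K n i)).det
      = (∏ i : Fin n, C (((i : ℕ) + 1 : ℕ) : K)) *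
        (Matrix.vandermonde (X : Fin n → MvPolynomial (Fin n) K)).det := by
    rw [← Matrix.det_transpose (Matrix.vandermonde _), ← Matrix.det_mul_column]
    congr 1
    ext1 i j
    simp only [Matrix.of_apply, pw, psum, map_sum, Matrix.transpose_apply, Matrix.vandermonde_apply]
    rw [Finset.sum_eq_single j]
    · rw [Derivation.leibniz_pow, pderiv_X_self]; simp
    · intro k _ hk
      rw [Derivation.leibniz_pow, pderiv_X_of_ne hk]; simp
    · simp
  rw [h, ← coinv_eq]
  intro hm
  apply vand_notMem (K := K) (n := n)
  have h0 : (∏ i : Fin n, (((i : ℕ) + 1 : ℕ) : K)) ≠ 0 :=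
    Finset.prod_ne_zero_iff.mpr fun i _ => Nat.cast_ne_zero.mpr (Nat.succ_ne_zero _)
  have h3 := Ideal.mul_mem_left _ (C ((∏ i : Fin n, (((i : ℕ) + 1 : ℕ) : K))⁻¹)) hm
  rw [← map_prod, ← mul_assoc, ← C_mul, inv_mul_cancel₀ h0, C_1, one_mul] at h3
  exact h3

end Coinv

section Saito

variable {K : Type*} [Field K] {n : ℕ}

lemma alp_dvd_iff (p : Fin (n + 1) × Fin (n + 1)) (g : MvPolynomial (Fin n) K) :
    alp K n p.1 p.2 ∣ g ↔ lin K p ∣ g := (lin_assoc p).dvd_iff_dvd_left.symm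

lemma alp_or (p : Fin (n + 1) × Fin (n + 1)) :
    alp K n p.1 p.2 = lin K p ∨ alp K n p.1 p.2 = - lin K p := by
  unfold alp lin
  split_ifs with h
  · left; rw [h, varx_zero, sub_zero]
  · right; ring

lemma dvd_der_alp (p : Fin (n + 1) × Fin (n + 1))
    (θ : Derivation K (MvPolynomial (Fin n) K) (MvPolynomial (Fin n) K)) :
    alp K n p.1 p.2 ∣ θ (alp K n p.1 p.2) ↔ lin K p ∣ θ (lin K p) := by
  rw [alp_dvd_iff]
  rcases alp_or (K := K) p with h | h <;> rw [h]
  rw [map_neg, dvd_neg]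

lemma mem_derOf (A : Finset (Fin (n + 1) × Fin (n + 1)))
    (θ : Derivation K (MvPolynomial (Fin n) K) (MvPolynomial (Fin n) K))
    (h : ∀ p ∈ A, lin K p ∣ θ (lin K p)) : θ ∈ DerOf K n (QA K n A) := by
  change QA K n A ∣ θ (QA K n A)
  unfold QA
  classical
  induction A using Finset.induction_on with
  | empty => simp
  | insert a s ha ih =>
    rw [Finset.prod_insert ha, Derivation.leibniz, smul_eq_mul, smul_eq_mul]
    have h1 := ih fun p hp => h p (Finset.mem_insert_of_mem hp)
    have h2 := (dvd_der_alp a θ).mpr (h a (Finset.mem_insert_self _ _))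
    exact dvd_add (mul_dvd_mul_left _ h1) (by rw [mul_comm]; exact mul_dvd_mul_left _ h2)

lemma derOf_dvd (A : Finset (Fin (n + 1) × Fin (n + 1))) (hA : ∀ p ∈ A, p.1 < p.2)
    (θ : Derivation K (MvPolynomial (Fin n) K) (MvPolynomial (Fin n) K))
    (h : θ ∈ DerOf K n (QA K n A)) (p : Fin (n + 1) × Fin (n + 1)) (hp : p ∈ A) :
    lin K p ∣ θ (lin K p) := by
  classical
  have h : QA K n A ∣ θ (QA K n A) := h
  rw [← dvd_der_alp, alp_dvd_iff]
  have hQ : QA K n A = alp K n p.1 p.2 * ∏ q ∈ A.erase p, alp K n q.1 q.2 :=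
    (Finset.mul_prod_erase A _ hp).symm
  have h1 : lin K p ∣ alp K n p.1 p.2 := (lin_assoc p).dvd
  have h2 : lin K p ∣ QA K n A := by rw [hQ]; exact h1.mul_right _
  have h3 := h2.trans h
  rw [hQ, Derivation.leibniz, smul_eq_mul, smul_eq_mul, dvd_add_right (h1.mul_right _)] at h3
  rcases (lin_prime p (hA p hp)).dvd_or_dvd h3 with h4 | h4
  · exfalso
    obtain ⟨q, hq, h5⟩ := ((lin_prime (K := K) p (hA p hp)).dvd_finsetProd_iff _).mp h4
    have h6 : lin K p ∣ lin K q := h5.trans (lin_assoc q).symm.dvd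
    have h7 := phi_lin_ne p q (hA p hp) (hA q (Finset.mem_of_mem_erase hq))
      ((lin_dvd_iff p (hA p hp) _).mp h6)
    exact Finset.ne_of_mem_erase hq h7.symm
  · exact h4

variable (K n) in
/-- evaluation of a derivation on the variables -/
def evl : Derivation K (MvPolynomial (Fin n) K) (MvPolynomial (Fin n) K)
    →ₗ[MvPolynomial (Fin n) K] (Fin n → MvPolynomial (Fin n) K) where
  toFun θ := fun k => θ (X k)
  map_add' := by intro a b; ext1 k; simp
  map_smul' := by intro c θ; ext1 k; simp

lemma evl_inj : Function.Injective (evl K n) := by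
  intro a b h
  exact MvPolynomial.derivation_ext fun i => congrFun h i

lemma evl_mk (v : Fin n → MvPolynomial (Fin n) K) : evl K n (mkDerivation K v) = v := by
  ext1 k; simp [evl, mkDerivation_X]

lemma smul_mem_derOf (q : MvPolynomial (Fin n) K)
    (θ : Derivation K (MvPolynomial (Fin n) K) (MvPolynomial (Fin n) K)) :
    q • θ ∈ DerOf K n q := ⟨θ q, by simp⟩

lemma derOf_finite (q : MvPolynomial (Fin n) K) :
    Module.Finite (MvPolynomial (Fin n) K) (DerOf K n q) :=
  Module.Finite.of_injective ((evl K n).comp (DerOf K n q).subtype)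
    (evl_inj.comp Subtype.val_injective)

lemma derOf_finrank (q : MvPolynomial (Fin n) K) (hq : q ≠ 0) :
    Module.finrank (MvPolynomial (Fin n) K) (DerOf K n q) = n := by
  have := derOf_finite q
  apply le_antisymm
  · have := LinearMap.finrank_le_finrank_of_injective
      (f := (evl K n).comp (DerOf K n q).subtype) (evl_inj.comp Subtype.val_injective)
    simpa using this
  · let F : (Fin n → MvPolynomial (Fin n) K) →ₗ[MvPolynomial (Fin n) K] (DerOf K n q) :=
      { toFun := fun v => ⟨q • mkDerivation K v, smul_mem_derOf q _⟩
        map_add' := by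
          intro a b
          apply Subtype.ext
          apply evl_inj
          simp [evl_mk]
        map_smul' := by
          intro a b
          apply Subtype.ext
          apply evl_inj
          simp only [RingHom.id_apply, SetLike.val_smul, map_smul, evl_mk]
          rw [smul_comm] }
    have hF : Function.Injective F := by
      intro a b h
      have h2 := congrArg (fun z : DerOf K n q => evl K n z.1) h
      simp only [F, LinearMap.coe_mk, AddHom.coe_mk, map_smul, evl_mk] at h2
      exact smul_right_injective _ hq h2
    have := LinearMap.finrank_le_finrank_of_injective (f := F) hF
    simpa using this

lemma der_lin (θ : Derivation K (MvPolynomial (Fin n) K) (MvPolynomial (Fin n) K))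
    (p : Fin (n + 1) × Fin (n + 1)) :
    θ (lin K p) = θ (varx K n p.2) - θ (varx K n p.1) := by
  rw [lin, map_sub]

/-- each form in `A` divides the coefficient determinant -/
lemma lin_dvd_det (A : Finset (Fin (n + 1) × Fin (n + 1))) (hA : ∀ p ∈ A, p.1 < p.2)
    (b : Fin n → DerOf K n (QA K n A)) (p : Fin (n + 1) × Fin (n + 1)) (hp : p ∈ A) :
    lin K p ∣ (Matrix.of fun j k => (b j).1 (X k)).det := by
  apply lin_dvd
  rw [AlgHom.map_det]
  have h : ∀ j, phi K p ((b j).1 (varx K n p.2)) = phi K p ((b j).1 (varx K n p.1)) := by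
    intro j
    have := (lin_dvd_iff p (hA p hp) _).mp (derOf_dvd A hA (b j).1 (b j).2 p hp)
    rw [der_lin, map_sub, sub_eq_zero] at this
    exact this
  have hlt := hA p hp
  obtain ⟨i, j⟩ := p
  induction j using Fin.cases with
  | zero => exact absurd hlt (by simp)
  | succ j =>
    induction i using Fin.cases with
    | zero =>
      refine Matrix.det_eq_zero_of_column_eq_zero j fun k => ?_
      have := h k
      simp only [varx_succ, varx_zero, map_zero] at this
      simpa using this
    | succ i =>
      refine Matrix.det_zero_of_column_eq (i := j) (j := i) ?_ fun k => ?_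
      · rintro rfl; exact lt_irrefl _ hlt
      · have := h k
        simp only [varx_succ] at this
        simpa using this

/-- Euler-type derivations -/
def eta (k : Fin n) : Derivation K (MvPolynomial (Fin n) K) (MvPolynomial (Fin n) K) :=
  mkDerivation K fun i => X i ^ ((k : ℕ) + 1)

lemma eta_varx (k : Fin n) (i : Fin (n + 1)) :
    eta k (varx K n i) = varx K n i ^ ((k : ℕ) + 1) := by
  induction i using Fin.cases with
  | zero => rw [varx_zero]; simp
  | succ i => rw [varx_succ]; simp [eta, mkDerivation_X]

lemma eta_mem (A : Finset (Fin (n + 1) × Fin (n + 1))) (k : Fin n) :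
    eta k ∈ DerOf K n (QA K n A) := by
  apply mem_derOf
  intro p _
  rw [der_lin, eta_varx, eta_varx]
  exact sub_dvd_pow_sub_pow _ _ _

lemma QA_assoc (A : Finset (Fin (n + 1) × Fin (n + 1))) :
    Associated (∏ p ∈ A, lin K p) (QA K n A) :=
  Associated.prod _ _ _ fun p _ => lin_assoc p

lemma betaA_assoc (A : Finset (Fin (n + 1) × Fin (n + 1))) :
    Associated (∏ p ∈ Finset.univ.filter fun p : Fin (n + 1) × Fin (n + 1) => p.1 < p.2 ∧ p ∉ A,
      lin K p) (betaA K n A) :=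
  Associated.prod _ _ _ fun p _ => lin_assoc p

lemma allP_split (A : Finset (Fin (n + 1) × Fin (n + 1))) (hA : ∀ p ∈ A, p.1 < p.2) :
    ∏ p ∈ allP n, lin K p = (∏ p ∈ A, lin K p) *
      ∏ p ∈ Finset.univ.filter fun p : Fin (n + 1) × Fin (n + 1) => p.1 < p.2 ∧ p ∉ A,
      lin K p := by
  classical
  rw [← Finset.prod_filter_mul_prod_filter_not (allP n) (fun p => p ∈ A)]
  congr 1
  · refine Finset.prod_congr ?_ fun _ _ => rfl
    ext p
    simp only [allP, Finset.mem_filter, Finset.mem_univ, true_and]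
    exact ⟨fun h => h.2, fun h => ⟨hA p h, h⟩⟩
  · refine Finset.prod_congr ?_ fun _ _ => rfl
    ext p
    simp [allP]

lemma prod_ne (A : Finset (Fin (n + 1) × Fin (n + 1))) (hA : ∀ p ∈ A, p.1 < p.2) :
    ∏ p ∈ A, lin K p ≠ 0 :=
  Finset.prod_ne_zero_iff.mpr fun p hp => (lin_prime p (hA p hp)).ne_zero

lemma saito (A : Finset (Fin (n + 1) × Fin (n + 1))) (hA : ∀ p ∈ A, p.1 < p.2)
    (b : Module.Basis (Fin n) (MvPolynomial (Fin n) K) (DerOf K n (QA K n A))) :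
    ∃ B : Matrix (Fin n) (Fin n) (MvPolynomial (Fin n) K),
      Associated B.det (betaA K n A) ∧ ∀ k, pw K n k = ∑ j, B k j * iMap K n (b j).1 := by
  classical
  set M : Matrix (Fin n) (Fin n) (MvPolynomial (Fin n) K) :=
    Matrix.of fun j k => (b j).1 (X k) with hM
  have expand : ∀ z : DerOf K n (QA K n A), z.1 = ∑ j, b.repr z j • (b j).1 := by
    intro z
    have := congrArg (DerOf K n (QA K n A)).subtype (b.sum_repr z)
    rw [map_sum] at this
    exact this.symm
  have expand2 : ∀ (z : DerOf K n (QA K n A)) (i : Fin n),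
      z.1 (X i) = ∑ j, b.repr z j * M j i := by
    intro z i
    have := congrFun (congrArg (evl K n) (expand z)) i
    rw [map_sum, Finset.sum_apply] at this
    exact this
  let e : Fin n → DerOf K n (QA K n A) := fun k => ⟨eta k, eta_mem A k⟩
  let B : Matrix (Fin n) (Fin n) (MvPolynomial (Fin n) K) := Matrix.of fun k j => b.repr (e k) j
  let c : Fin n → DerOf K n (QA K n A) := fun k =>
    ⟨QA K n A • mkDerivation K (Pi.single k 1), smul_mem_derOf _ _⟩
  let N : Matrix (Fin n) (Fin n) (MvPolynomial (Fin n) K) := Matrix.of fun k j => b.repr (c k) j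
  have hBM : B * M = Matrix.of fun k i : Fin n => (X i : MvPolynomial (Fin n) K) ^ ((k : ℕ) + 1) := by
    ext1 k i
    rw [Matrix.of_apply, Matrix.mul_apply]
    refine (expand2 (e k) i).symm.trans ?_
    simp [e, eta, mkDerivation_X]
  have hNM : N * M = QA K n A • (1 : Matrix (Fin n) (Fin n) (MvPolynomial (Fin n) K)) := by
    ext1 k i
    rw [Matrix.mul_apply]
    refine (expand2 (c k) i).symm.trans ?_
    simp [c, mkDerivation_X, Matrix.one_apply, Pi.single_apply, eq_comm]
  have hdB : B.det * M.det = ∏ p ∈ allP n, lin K p := by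
    rw [← Matrix.det_mul, hBM, det_eta]
  have hdN : N.det * M.det = QA K n A ^ n := by
    rw [← Matrix.det_mul, hNM, Matrix.det_smul, Matrix.det_one]; simp
  refine ⟨B, ?_, ?_⟩
  · obtain ⟨w, hw⟩ : ∏ p ∈ A, lin K p ∣ M.det :=
      prod_lin_dvd A hA _ fun p hp => lin_dvd_det A hA b p hp
    rw [allP_split A hA, hw, mul_left_comm] at hdB
    have h1 := mul_left_cancel₀ (prod_ne A hA) hdB
    have h0 : w ∣ M.det := by rw [hw]; exact Dvd.intro_left _ rfl
    have h2 : w ∣ (∏ p ∈ A, lin K p) ^ n :=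
      h0.trans ((Dvd.intro_left _ hdN).trans ((QA_assoc A).pow_pow).symm.dvd)
    have h3 : IsRelPrime ((∏ p ∈ A, lin K p) ^ n)
      (∏ p ∈ Finset.univ.filter fun p : Fin (n + 1) × Fin (n + 1) => p.1 < p.2 ∧ p ∉ A,
        lin K p) := by
      apply IsRelPrime.pow_left
      refine IsRelPrime.prod_left fun p hp => IsRelPrime.prod_right fun q hq => ?_
      simp only [Finset.mem_filter, Finset.mem_univ, true_and] at hq
      exact lin_relPrime p q (hA p hp) hq.1 fun h => hq.2 (h ▸ hp)
    have h4 : IsUnit w := h3 h2 (Dvd.intro_left _ h1)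
    refine Associated.trans ?_ (betaA_assoc A)
    rw [← h1]
    exact (associated_mul_unit_right _ _ h4)
  · intro k
    have := congrArg (iMap K n) (expand (e k))
    rw [map_sum] at this
    simp only [map_smul, smul_eq_mul] at this
    rw [show pw K n k = iMap K n (e k).1 by simp [pw, psum, iMap, e, eta, mkDerivation_X], this]
    rfl

end Saito

theorem statement10 (K : Type*) [Field K] [CharZero K] (n : ℕ) (hn : 0 < n)
    (A : Finset (Fin (n + 1) × Fin (n + 1))) (hA : ∀ p ∈ A, p.1 < p.2)
    (hfree : Module.Free (MvPolynomial (Fin n) K) (DerOf K n (QA K n A))) :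
    iIdeal K n A = (coinvIdeal K n).colon (Ideal.span {betaA K n A}) := by
  have hQ : QA K n A ≠ 0 := fun h => prod_ne A hA ((QA_assoc A).eq_zero_iff.mpr h)
  have hfin := derOf_finite (QA K n A)
  let b : Module.Basis (Fin n) (MvPolynomial (Fin n) K) (DerOf K n (QA K n A)) :=
    Module.finBasisOfFinrankEq _ _ (derOf_finrank _ hQ)
  obtain ⟨B, hB, hp⟩ := saito A hA b
  have hI : iIdeal K n A = Ideal.span (Set.range fun j => iMap K n (b j).1) := by
    unfold iIdeal
    have h1 : DerOf K n (QA K n A) =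
        Submodule.span _ (Set.range fun j => (b j).1) := by
      have h2 := congrArg (Submodule.map (DerOf K n (QA K n A)).subtype) b.span_eq
      rw [Submodule.map_span, Submodule.map_top, Submodule.range_subtype, ← Set.range_comp] at h2
      exact h2.symm
    conv_lhs => rw [h1]
    rw [Submodule.map_span, ← Set.range_comp]
    rfl
  have hdvd : ∀ g, betaA K n A * g ∈ Ideal.span (Set.range (pw K n)) ↔
      B.det * g ∈ Ideal.span (Set.range (pw K n)) := by
    intro g
    obtain ⟨u, hu⟩ := hB
    constructor
    · intro h
      have := Ideal.mul_mem_left _ ((u⁻¹ : (MvPolynomial (Fin n) K)ˣ) : MvPolynomial (Fin n) K) h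
      rw [← hu] at this
      rw [mul_right_comm, mul_comm, mul_assoc, Units.mul_inv, mul_one] at this
      exact this
    · intro h
      rw [← hu, mul_right_comm]
      exact Ideal.mul_mem_right _ _ h
  rw [hI, coinv_eq]
  ext g
  rw [show g ∈ (Ideal.span (Set.range (pw K n))).colon (Ideal.span {betaA K n A}) ↔
    betaA K n A * g ∈ Ideal.span (Set.range (pw K n)) by
      rw [mul_comm, ← smul_eq_mul]; exact Submodule.mem_colon_span_singleton, hdvd]
  constructor
  · intro hg
    induction hg using Submodule.span_induction with
    | zero => simp
    | add x y _ _ hx hy => rw [mul_add]; exact Ideal.add_mem _ hx hy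
    | smul c x _ hx => rw [smul_eq_mul, mul_left_comm]; exact Ideal.mul_mem_left _ _ hx
    | mem x hx =>
      obtain ⟨j, rfl⟩ := hx
      exact cramer_mem B _ _ hp j
  · intro hg
    exact wiebe (pw K n) _ B hp quot_fin quot_loc jac_notMem g hg
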